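/- Let H be a real inner product space, let a : H → H → ℝ be a symmetric bilinear form with a(v,v) ≥ 0 for all v ∈ H, and let b : H → H → ℝ be a bilinear form satisfying |b(u,v)| ≤ (1/2)·√(a(u,u))·√(a(v,v)) for all u,v ∈ H. Let Δt > 0, let x, y, f ∈ H and F ≥ 0 with ⟨f, y⟩ ≤ F·√(a(y,y)), and suppose the one-step relation ⟨(y − x)/Δt, y⟩ + a(y, y) + b(x, y) = ⟨f, y⟩ holds. Then (1/2)·(‖y‖² − ‖x‖² + ‖y − x‖²) + (Δt/2)·(a(y,y) − a(x,x)) + (Δt/8)·a(y,y) ≤ 2Δt·F². -/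

import Mathlib

open scoped RealInnerProductSpace

/-- One-step energy inequality for the first-order ensemble scheme (proof of Theorem 1). -/
theorem first_order_one_step_energy_inequality
    {H : Type*} [NormedAddCommGroup H] [InnerProductSpace ℝ H]
    (a b : H →ₗ[ℝ] H →ₗ[ℝ] ℝ)
    (ha_symm : ∀ u v : H, a u v = a v u)
    (ha_nonneg : ∀ v : H, 0 ≤ a v v)
    (hb : ∀ u v : H, |b u v| ≤ (1/2) * Real.sqrt (a u u) * Real.sqrt (a v v))
    (Δt : ℝ) (hΔt : 0 < Δt)
    (x y f : H) (F : ℝ) (hF : 0 ≤ F)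
    (hf : ⟪f, y⟫ ≤ F * Real.sqrt (a y y))
    (hstep : ⟪Δt⁻¹ • (y - x), y⟫ + a y y + b x y = ⟪f, y⟫) :
    (1/2) * (‖y‖^2 - ‖x‖^2 + ‖y - x‖^2)
      + (Δt/2) * (a y y - a x x) + (Δt/8) * a y y
    ≤ 2 * Δt * F^2 := by
  have polar : ⟪y - x, y⟫ = (1/2) * (‖y‖^2 - ‖x‖^2 + ‖y - x‖^2) := by
    have h := norm_sub_sq_real y (y - x)
    rw [sub_sub_cancel, real_inner_comm] at h
    linarith
  rw [real_inner_smul_left] at hstep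
  have scaled : ⟪y - x, y⟫ = Δt * (⟪f, y⟫ - a y y - b x y) := by
    rw [← hstep]
    field_simp
    ring
  have hx := Real.sq_sqrt (ha_nonneg x)
  have hy := Real.sq_sqrt (ha_nonneg y)
  have hbxy := (abs_le.mp (hb x y)).1
  have unscaled : ⟪f, y⟫ - a y y - b x y + (1/2) * (a y y - a x x) + (1/8) * a y y
      ≤ 2 * F^2 := by
    nlinarith [sq_nonneg (F - √(a y y) / 2), sq_nonneg (√(a x x) - √(a y y) / 2), sq_nonneg F]
  rw [← polar, scaled]
  linarith [mul_le_mul_of_nonneg_left unscaled hΔt.le]
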